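/- If G is an m-free digraph with m ≥ 4, then β(G) ≤ γ(G)/(m−2), where β(G) is the minimum size of a feedback arc set and γ(G) the number of unordered nonadjacent vertex pairs. -/

import Mathlib

/-- A simple digraph: no loops, no parallel arcs (antiparallel arcs allowed). -/
structure SimpleDigraph (V : Type*) where
  Adj : V → V → Prop
  irrefl : ∀ v, ¬ Adj v v

namespace SimpleDigraph

variable {V : Type*}

/-- There is a directed walk from `u` to `w` with exactly `k` arcs. -/
def HasWalk (G : SimpleDigraph V) (u w : V) (k : ℕ) : Prop :=
  ∃ p : ℕ → V, p 0 = u ∧ p k = w ∧ ∀ i < k, G.Adj (p i) (p (i + 1))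

/-- The directed distance from `u` to `w` equals `k`. -/
def DistEq (G : SimpleDigraph V) (u w : V) (k : ℕ) : Prop :=
  G.HasWalk u w k ∧ ∀ j, G.HasWalk u w j → k ≤ j

/-- Vertices at directed distance exactly `i` from `v`. -/
def Nplus (G : SimpleDigraph V) (i : ℕ) (v : V) : Set V := {u | G.DistEq v u i}

/-- Vertices whose directed distance to `v` is exactly `i`. -/
def Nminus (G : SimpleDigraph V) (i : ℕ) (v : V) : Set V := {u | G.DistEq u v i}

def arcSet (G : SimpleDigraph V) : Set (V × V) := {e | G.Adj e.1 e.2}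

/-- The set of arcs from `A` to `B`. -/
def arcsBetween (G : SimpleDigraph V) (A B : Set V) : Set (V × V) :=
  {e | e.1 ∈ A ∧ e.2 ∈ B ∧ G.Adj e.1 e.2}

/-- `u` and `w` are nonadjacent: no arc in either direction. -/
def Nonadj (G : SimpleDigraph V) (u w : V) : Prop := ¬ G.Adj u w ∧ ¬ G.Adj w u

/-- Missing (nonadjacent) unordered pairs with one endpoint in `A`, the other in `B`. -/
def missingPairs (G : SimpleDigraph V) (A B : Set V) : Set (Sym2 V) :=
  {p | ∃ a ∈ A, ∃ b ∈ B, p = s(a, b) ∧ a ≠ b ∧ G.Nonadj a b}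

/-- A directed cycle, given as its list of (distinct) vertices. -/
def IsCycle (G : SimpleDigraph V) (l : List V) : Prop :=
  l ≠ [] ∧ l.Nodup ∧ l.Chain' G.Adj ∧
    ∃ a b, l.getLast? = some a ∧ l.head? = some b ∧ G.Adj a b

def Acyclic (G : SimpleDigraph V) : Prop := ∀ l : List V, ¬ G.IsCycle l

/-- `G` is `m`-free: no directed cycle of length at most `m`. -/
def MFree (G : SimpleDigraph V) (m : ℕ) : Prop :=
  ∀ l : List V, G.IsCycle l → m < l.length

def deleteArcs (G : SimpleDigraph V) (X : Set (V × V)) : SimpleDigraph V :=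
  ⟨fun a b => G.Adj a b ∧ (a, b) ∉ X, fun v h => G.irrefl v h.1⟩

/-- The induced subdigraph on a vertex set `A`. -/
def induce (G : SimpleDigraph V) (A : Set V) : SimpleDigraph A :=
  ⟨fun a b => G.Adj a b, fun a h => G.irrefl a h⟩

/-- Minimum size of a feedback arc set. -/
noncomputable def beta (G : SimpleDigraph V) : ℕ :=
  sInf {n | ∃ X : Set (V × V), X ⊆ G.arcSet ∧ X.ncard = n ∧ (G.deleteArcs X).Acyclic}

/-- Number of unordered pairs of distinct nonadjacent vertices. -/
noncomputable def gamma (G : SimpleDigraph V) : ℕ :=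
  {p : Sym2 V | ¬ p.IsDiag ∧ ∀ u w, p = s(u, w) → G.Nonadj u w}.ncard

/-- `l` is a shortest (hence induced) directed path of length `k`:
it has `k+1` distinct vertices, consecutive arcs, and the directed distance
between its endpoints equals `k`. -/
def IsShortestPath (G : SimpleDigraph V) (l : List V) (k : ℕ) : Prop :=
  l.length = k + 1 ∧ l.Nodup ∧ l.Chain' G.Adj ∧
    ∃ a b, l.head? = some a ∧ l.getLast? = some b ∧ G.DistEq a b k

end SimpleDigraph

/-- Walks of length `k` along a relation. -/
def RelWalk {V : Type*} (r : V → V → Prop) : ℕ → V → V → Prop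
  | 0, u, w => u = w
  | k + 1, u, w => ∃ x, r u x ∧ RelWalk r k x w

namespace RelWalk

variable {V : Type*} {r : V → V → Prop}

theorem one {u w : V} (h : r u w) : RelWalk r 1 u w := ⟨w, h, rfl⟩

theorem trans {j k : ℕ} {u v w : V} (h : RelWalk r j u v) (h' : RelWalk r k v w) :
    RelWalk r (j + k) u w := by
  induction j generalizing u with
  | zero => cases h; simpa using h'
  | succ j ih =>
    obtain ⟨x, hx, hw⟩ := h
    rw [Nat.add_right_comm]
    exact ⟨x, hx, ih hw⟩

theorem snoc {k : ℕ} {u v w : V} (h : RelWalk r k u v) (h' : r v w) :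
    RelWalk r (k + 1) u w := h.trans (one h')

theorem swap {k : ℕ} {u w : V} (h : RelWalk r k u w) : RelWalk (Function.swap r) k w u := by
  induction k generalizing u with
  | zero => exact h.symm
  | succ k ih =>
    obtain ⟨x, hx, hw⟩ := h
    exact (ih hw).snoc hx

theorem swap_iff {k : ℕ} {u w : V} : RelWalk (Function.swap r) k w u ↔ RelWalk r k u w :=
  ⟨fun h => h.swap, fun h => h.swap⟩

theorem mono {s : V → V → Prop} (hrs : ∀ a b, r a b → s a b) {k : ℕ} {u w : V}
    (h : RelWalk r k u w) : RelWalk s k u w := by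
  induction k generalizing u with
  | zero => exact h
  | succ k ih =>
    obtain ⟨x, hx, hw⟩ := h
    exact ⟨x, hrs _ _ hx, ih hw⟩

theorem of_fun {p : ℕ → V} {a k : ℕ} (h : ∀ i < k, r (p (a + i)) (p (a + i + 1))) :
    RelWalk r k (p a) (p (a + k)) := by
  induction k with
  | zero => rfl
  | succ k ih => exact (ih fun i hi => h i (by omega)).snoc (h k (by omega))

theorem exists_fun {k : ℕ} {u w : V} (h : RelWalk r k u w) :
    ∃ p : ℕ → V, p 0 = u ∧ p k = w ∧ ∀ i < k, r (p i) (p (i + 1)) := by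
  induction k generalizing u with
  | zero => exact ⟨fun _ => u, rfl, h, by simp⟩
  | succ k ih =>
    obtain ⟨x, hx, hw⟩ := h
    obtain ⟨p, h0, hk, hp⟩ := ih hw
    refine ⟨fun n => Nat.casesOn n u p, rfl, hk, fun i hi => ?_⟩
    cases i with
    | zero => simpa [h0] using hx
    | succ i => exact hp i (by omega)

theorem target_mem {S : Finset V} (hS : ∀ a b, r a b → a ∈ S ∧ b ∈ S) {k : ℕ} {u w : V}
    (hk : 1 ≤ k) (h : RelWalk r k u w) : w ∈ S := by
  obtain ⟨p, -, rfl, hp⟩ := h.exists_fun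
  obtain ⟨k, rfl⟩ := Nat.exists_eq_add_of_le' hk
  exact (hS _ _ (hp k (by omega))).2

end RelWalk

/-- The distance from `u` to `w` along `r` equals `k`. -/
def RelDist {V : Type*} (r : V → V → Prop) (k : ℕ) (u w : V) : Prop :=
  RelWalk r k u w ∧ ∀ j < k, ¬ RelWalk r j u w

theorem RelDist.swap_iff {V : Type*} {r : V → V → Prop} {k : ℕ} {u w : V} :
    RelDist (Function.swap r) k w u ↔ RelDist r k u w := by
  simp only [RelDist, RelWalk.swap_iff]

theorem RelDist.unique {V : Type*} {r : V → V → Prop} {j k : ℕ} {u w : V}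
    (h : RelDist r j u w) (h' : RelDist r k u w) : j = k := by
  rcases lt_trichotomy j k with hlt | rfl | hlt
  · exact absurd h.1 (h'.2 _ hlt)
  · rfl
  · exact absurd h'.1 (h.2 _ hlt)

/-- `r` has no closed walk of length between `1` and `m`. -/
def RelFree {V : Type*} (r : V → V → Prop) (m : ℕ) : Prop :=
  ∀ k v, 1 ≤ k → k ≤ m → ¬ RelWalk r k v v

theorem RelFree.swap {V : Type*} {r : V → V → Prop} {m : ℕ} (hr : RelFree r m) :
    RelFree (Function.swap r) m :=
  fun k v h1 hm hw => hr k v h1 hm hw.swap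

/-- The vertices reached from `v` by a walk of length between `1` and `i`. -/
def outBall {V : Type*} (r : V → V → Prop) (i : ℕ) (v : V) : Set V :=
  {x | ∃ j, 1 ≤ j ∧ j ≤ i ∧ RelWalk r j v x}

section Cuts

open Classical Finset

variable {V : Type*} [Fintype V] {r : V → V → Prop} {S : Finset V} {m i : ℕ}

/-- The arcs leaving an out-ball of radius `i` join distance `i` to distance `i + 1`. -/
theorem card_arcs_outBall_le (hr : RelFree r m) (hi : 1 ≤ i) (him : i + 2 ≤ m) :
    #{t : V × V × V | t.2.1 ∈ outBall r i t.1 ∧ t.2.2 ∉ outBall r i t.1 ∧ r t.2.1 t.2.2} ≤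
      #{t : V × V × V | r t.2.1 t.2.2 ∧ RelDist r i t.1 t.2.1 ∧ RelDist r (i + 1) t.1 t.2.2} := by
  refine card_le_card ?_
  rintro ⟨v, x, y⟩
  simp only [mem_filter, mem_univ, true_and]
  rintro ⟨⟨j, hj1, hji, hj⟩, hy, hxy⟩
  have hlen : ∀ k, 1 ≤ k → k ≤ i → RelWalk r k v x → k = i := by
    intro k hk1 hki hk
    by_contra hne
    exact hy ⟨k + 1, by omega, by omega, hk.snoc hxy⟩
  obtain rfl := hlen j hj1 hji hj
  refine ⟨hxy, ⟨hj, fun k hk hw => ?_⟩, hj.snoc hxy, fun k hk hw => ?_⟩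
  · rcases Nat.eq_zero_or_pos k with rfl | hk0
    · cases hw
      exact hr j v hj1 (by omega) hj
    · have := hlen k hk0 hk.le hw
      omega
  · rcases Nat.eq_zero_or_pos k with rfl | hk0
    · cases hw
      exact hr (j + 1) v (by omega) (by omega) (hj.snoc hxy)
    · exact hy ⟨k, hk0, by omega, hw⟩

/-- An arc `y → x` together with a vertex `u` whose distance from `x` is `j` and from `y` is `j + 1`
yields a nonadjacent pair separated by an out-ball of radius `i`, centred at `x` if `j ≤ i` and
at `y` otherwise. -/
theorem sum_card_le_card_nonadj (hS : ∀ a b, r a b → a ∈ S ∧ b ∈ S) (hr : RelFree r m)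
    (hi : 1 ≤ i) (him : i + 1 ≤ m) :
    ∑ j ∈ Icc 1 (m - 2),
      #{t : V × V × V | r t.1 t.2.1 ∧ RelDist r j t.2.1 t.2.2 ∧ RelDist r (j + 1) t.1 t.2.2} ≤
    #{t : V × V × V | t.2.1 ∈ outBall r i t.1 ∧ (t.2.2 ∈ S ∧ t.2.2 ∉ outBall r i t.1) ∧
      ¬ r t.2.1 t.2.2 ∧ ¬ r t.2.2 t.2.1} := by
  rw [← card_sigma]
  refine card_le_card_of_injOn
    (fun s => if s.1 ≤ i then (s.2.2.1, s.2.2.2, s.2.1) else s.2) ?_ ?_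
  · rintro ⟨j, y, x, u⟩ h
    simp only [coe_sigma, Set.mem_sigma_iff, coe_Icc, Set.mem_Icc, coe_filter, mem_univ,
      true_and, Set.mem_ofPred_eq] at h
    obtain ⟨⟨hj1, hjm⟩, hyx, hxu, hyu⟩ := h
    simp only [coe_filter, mem_univ, true_and, Set.mem_ofPred_eq]
    split_ifs with hji
    · refine ⟨⟨j, hj1, hji, hxu.1⟩, ⟨(hS _ _ hyx).1, ?_⟩, fun h => ?_, fun h => ?_⟩
      · rintro ⟨k, hk1, hki, hk⟩
        exact hr _ _ (by omega) (by omega) (hk.snoc hyx)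
      · exact hr _ _ (by omega) (by omega) ((hxu.1.snoc h).snoc hyx)
      · exact hyu.2 1 (by omega) (.one h)
    · refine ⟨⟨1, le_rfl, hi, .one hyx⟩, ⟨hxu.1.target_mem hS hj1, ?_⟩, fun h => ?_, fun h => ?_⟩
      · rintro ⟨k, hk1, hki, hk⟩
        exact hyu.2 k (by omega) hk
      · exact hxu.2 1 (by omega) (.one h)
      · exact hr _ _ (by omega) (by omega) (hxu.1.snoc h)
  · rintro ⟨j, y, x, u⟩ h ⟨j', y', x', u'⟩ h' heq
    simp only [coe_sigma, Set.mem_sigma_iff, coe_Icc, Set.mem_Icc, coe_filter, mem_univ,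
      true_and, Set.mem_ofPred_eq] at h h'
    obtain ⟨⟨hj1, hjm⟩, hyx, hxu, hyu⟩ := h
    obtain ⟨⟨hj1', hjm'⟩, hyx', hxu', hyu'⟩ := h'
    simp only at heq
    split_ifs at heq <;> simp only [Prod.mk.injEq] at heq <;> obtain ⟨rfl, rfl, rfl⟩ := heq
    · obtain rfl := hxu.unique hxu'; rfl
    · exact absurd (hyu'.1.snoc hyx) (hr _ _ (by omega) (by omega))
    · exact absurd (hyu.1.snoc hyx') (hr _ _ (by omega) (by omega))
    · obtain rfl := hxu.unique hxu'; rfl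

theorem card_filter_triple (p : V → V → V → Prop) [∀ a b c, Decidable (p a b c)] :
    #{t : V × V × V | p t.1 t.2.1 t.2.2} = ∑ v, #{t : V × V | p v t.1 t.2} := by
  simp only [card_filter, Fintype.sum_prod_type]

theorem exists_outBall_cut (hm : 4 ≤ m) (hS : ∀ a b, r a b → a ∈ S ∧ b ∈ S) (hr : RelFree r m)
    (hne : ∃ a b, r a b)
    (hle : ∑ j ∈ Icc 1 (m - 2),
      #{t : V × V × V | r t.2.1 t.2.2 ∧ RelDist r j t.1 t.2.1 ∧ RelDist r (j + 1) t.1 t.2.2} ≤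
      ∑ j ∈ Icc 1 (m - 2),
      #{t : V × V × V | r t.1 t.2.1 ∧ RelDist r j t.2.1 t.2.2 ∧ RelDist r (j + 1) t.1 t.2.2}) :
    ∃ X ⊆ S, X.Nonempty ∧ (S \ X).Nonempty ∧
      (m - 2) * #{t : V × V | t.1 ∈ X ∧ t.2 ∈ S \ X ∧ r t.1 t.2} ≤
        #{t : V × V | t.1 ∈ X ∧ t.2 ∈ S \ X ∧ ¬ r t.1 t.2 ∧ ¬ r t.2 t.1} := by
  by_contra hcon
  have hlt : ∀ i ∈ Icc 1 (m - 2), ∀ v, (∃ w, r v w) →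
      #{t : V × V | t.1 ∈ outBall r i v ∧ (t.2 ∈ S ∧ t.2 ∉ outBall r i v) ∧
        ¬ r t.1 t.2 ∧ ¬ r t.2 t.1} <
      (m - 2) * #{t : V × V | t.1 ∈ outBall r i v ∧ t.2 ∉ outBall r i v ∧ r t.1 t.2} := by
    rintro i hi v ⟨w, hvw⟩
    rw [mem_Icc] at hi
    by_contra hge
    rw [not_lt] at hge
    have hsub : ∀ x ∈ outBall r i v, x ∈ S := fun x ⟨j, hj, _, hw⟩ => hw.target_mem hS hj
    refine hcon ⟨({x | x ∈ outBall r i v} : Finset V), fun x hx => hsub x (by simpa using hx),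
      ⟨w, ?_⟩, ⟨v, ?_⟩, ?_⟩
    · simpa using ⟨1, le_rfl, hi.1, RelWalk.one hvw⟩
    · simp only [mem_sdiff, mem_filter, mem_univ, true_and]
      exact ⟨(hS _ _ hvw).1, fun ⟨j, hj1, hji, hw⟩ => hr j v hj1 (by omega) hw⟩
    · simp only [mem_sdiff, mem_filter, mem_univ, true_and]
      refine le_trans (Nat.mul_le_mul_left _ (card_le_card fun t => ?_)) hge
      simp only [mem_filter, mem_univ, true_and]
      tauto
  have hzero : ∀ i v, (¬ ∃ w, r v w) →
      #{t : V × V | t.1 ∈ outBall r i v ∧ (t.2 ∈ S ∧ t.2 ∉ outBall r i v) ∧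
        ¬ r t.1 t.2 ∧ ¬ r t.2 t.1} = 0 := by
    intro i v hv
    rw [card_eq_zero, filter_eq_empty_iff]
    rintro t - ⟨⟨j, hj, -, hw⟩, -⟩
    obtain ⟨j, rfl⟩ := Nat.exists_eq_add_of_le' hj
    obtain ⟨x, hx, -⟩ := hw
    exact hv ⟨x, hx⟩
  have hlow : (m - 2) * ∑ j ∈ Icc 1 (m - 2),
      #{t : V × V × V | r t.1 t.2.1 ∧ RelDist r j t.2.1 t.2.2 ∧ RelDist r (j + 1) t.1 t.2.2} ≤
      ∑ i ∈ Icc 1 (m - 2), ∑ v,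
        #{t : V × V | t.1 ∈ outBall r i v ∧ (t.2 ∈ S ∧ t.2 ∉ outBall r i v) ∧
          ¬ r t.1 t.2 ∧ ¬ r t.2 t.1} := by
    have := card_nsmul_le_sum (Icc 1 (m - 2)) (fun i => ∑ v,
        #{t : V × V | t.1 ∈ outBall r i v ∧ (t.2 ∈ S ∧ t.2 ∉ outBall r i v) ∧
          ¬ r t.1 t.2 ∧ ¬ r t.2 t.1}) _ fun i hi => by
      rw [← card_filter_triple fun v a b => a ∈ outBall r i v ∧ (b ∈ S ∧ b ∉ outBall r i v) ∧
        ¬ r a b ∧ ¬ r b a]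
      exact sum_card_le_card_nonadj hS hr (mem_Icc.1 hi).1 (by have := (mem_Icc.1 hi).2; omega)
    simpa using this
  have hupp : ∑ i ∈ Icc 1 (m - 2), ∑ v,
      (m - 2) * #{t : V × V | t.1 ∈ outBall r i v ∧ t.2 ∉ outBall r i v ∧ r t.1 t.2} ≤
      (m - 2) * ∑ j ∈ Icc 1 (m - 2),
      #{t : V × V × V | r t.2.1 t.2.2 ∧ RelDist r j t.1 t.2.1 ∧ RelDist r (j + 1) t.1 t.2.2} := by
    simp only [← mul_sum]
    refine Nat.mul_le_mul_left _ (sum_le_sum fun i hi => ?_)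
    rw [mem_Icc] at hi
    rw [← card_filter_triple fun v a b => a ∈ outBall r i v ∧ b ∉ outBall r i v ∧ r a b]
    exact card_arcs_outBall_le hr hi.1 (by omega)
  obtain ⟨a, b, hab⟩ := hne
  have hstrict : ∑ i ∈ Icc 1 (m - 2), ∑ v,
        #{t : V × V | t.1 ∈ outBall r i v ∧ (t.2 ∈ S ∧ t.2 ∉ outBall r i v) ∧
          ¬ r t.1 t.2 ∧ ¬ r t.2 t.1} <
      ∑ i ∈ Icc 1 (m - 2), ∑ v,
      (m - 2) * #{t : V × V | t.1 ∈ outBall r i v ∧ t.2 ∉ outBall r i v ∧ r t.1 t.2} := by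
    refine sum_lt_sum_of_nonempty ⟨1, mem_Icc.2 ⟨le_rfl, by omega⟩⟩ fun i hi => ?_
    refine sum_lt_sum (fun v _ => ?_) ⟨a, mem_univ a, hlt i hi a ⟨b, hab⟩⟩
    by_cases hv : ∃ w, r v w
    · exact (hlt i hi v hv).le
    · rw [hzero i v hv]
      exact Nat.zero_le _
  have := Nat.mul_le_mul_left (m - 2) hle
  omega

theorem card_triple_swap (j : ℕ) :
    #{t : V × V × V | Function.swap r t.2.1 t.2.2 ∧ RelDist (Function.swap r) j t.1 t.2.1 ∧
      RelDist (Function.swap r) (j + 1) t.1 t.2.2} =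
    #{t : V × V × V | r t.1 t.2.1 ∧ RelDist r j t.2.1 t.2.2 ∧ RelDist r (j + 1) t.1 t.2.2} := by
  simp only [RelDist.swap_iff]
  refine card_bij' (fun t _ => (t.2.2, t.2.1, t.1)) (fun t _ => (t.2.2, t.2.1, t.1)) ?_ ?_ ?_ ?_ <;>
    simp [Function.swap]

/-- A cut with few forward arcs compared with its nonadjacent pairs. -/
theorem exists_sparse_cut (hm : 4 ≤ m) (hS : ∀ a b, r a b → a ∈ S ∧ b ∈ S) (hr : RelFree r m)
    (hne : ∃ a b, r a b) :
    ∃ X ⊆ S, X.Nonempty ∧ (S \ X).Nonempty ∧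
      (m - 2) * #{t : V × V | t.1 ∈ X ∧ t.2 ∈ S \ X ∧ r t.1 t.2} ≤
        #{t : V × V | t.1 ∈ X ∧ t.2 ∈ S \ X ∧ ¬ r t.1 t.2 ∧ ¬ r t.2 t.1} := by
  rcases le_total (∑ j ∈ Icc 1 (m - 2),
      #{t : V × V × V | r t.2.1 t.2.2 ∧ RelDist r j t.1 t.2.1 ∧ RelDist r (j + 1) t.1 t.2.2})
      (∑ j ∈ Icc 1 (m - 2),
      #{t : V × V × V | r t.1 t.2.1 ∧ RelDist r j t.2.1 t.2.2 ∧ RelDist r (j + 1) t.1 t.2.2})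
      with hle | hle
  · exact exists_outBall_cut hm hS hr hne hle
  · obtain ⟨X, hXS, hX, hY, h⟩ := exists_outBall_cut (r := Function.swap r) hm
      (fun a b h => (hS b a h).symm) hr.swap (by obtain ⟨a, b, h⟩ := hne; exact ⟨b, a, h⟩)
      ((sum_congr rfl fun j _ => card_triple_swap j).trans_le
        (hle.trans_eq (sum_congr rfl fun j _ => card_triple_swap (r := Function.swap r) j)))
    refine ⟨S \ X, sdiff_subset, hY, ?_, ?_⟩
    · rwa [Finset.sdiff_sdiff_eq_self hXS]
    · rw [Finset.sdiff_sdiff_eq_self hXS]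
      refine (Nat.mul_le_mul_left _ ?_).trans (h.trans ?_)
      · refine card_le_card_of_injOn Prod.swap ?_ Prod.swap_injective.injOn
        rintro ⟨a, b⟩
        simp [Function.swap]
        tauto
      · refine card_le_card_of_injOn Prod.swap ?_ Prod.swap_injective.injOn
        rintro ⟨a, b⟩
        simp [Function.swap]
        tauto

/-- A vertex ranking with few backward arcs compared with the nonadjacent ordered pairs. -/
theorem exists_rank (hm : 4 ≤ m) (hr : RelFree r m) (S : Finset V) :
    ∃ f : V → ℕ, 2 * ((m - 2) * #{t : V × V | t.1 ∈ S ∧ t.2 ∈ S ∧ r t.1 t.2 ∧ f t.2 ≤ f t.1}) ≤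
      #{t : V × V | t.1 ∈ S ∧ t.2 ∈ S ∧ t.1 ≠ t.2 ∧ ¬ r t.1 t.2 ∧ ¬ r t.2 t.1} := by
  induction S using Finset.strongInduction with
  | H S ih =>
  by_cases hne : ∃ a b, a ∈ S ∧ b ∈ S ∧ r a b
  swap
  · refine ⟨fun _ => 0, ?_⟩
    rw [filter_eq_empty_iff.2]
    · simp
    · rintro t - ⟨h1, h2, h3, -⟩
      exact hne ⟨_, _, h1, h2, h3⟩
  obtain ⟨a, b, ha, hb, hab⟩ := hne
  obtain ⟨X, hXS, hX, hY, hcut⟩ := exists_sparse_cut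
    (r := fun a b => a ∈ S ∧ b ∈ S ∧ r a b) (S := S) hm (fun _ _ h => ⟨h.1, h.2.1⟩)
    (fun k v h1 h2 hw => hr k v h1 h2 (hw.mono fun _ _ h => h.2.2)) ⟨a, b, ha, hb, hab⟩
  obtain ⟨f, hf⟩ := ih X (hXS.ssubset_of_ne (by rintro rfl; simp at hY))
  obtain ⟨g, hg⟩ := ih (S \ X) (sdiff_ssubset hXS hX)
  have hbound : ∀ y, g y ≤ univ.sup g := fun y => le_sup (mem_univ y)
  refine ⟨fun x => if x ∈ X then f x + univ.sup g + 1 else g x, ?_⟩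
  have harcs : #{t : V × V | t.1 ∈ S ∧ t.2 ∈ S ∧ r t.1 t.2 ∧
        (if t.2 ∈ X then f t.2 + univ.sup g + 1 else g t.2) ≤
          (if t.1 ∈ X then f t.1 + univ.sup g + 1 else g t.1)} ≤
      #{t : V × V | t.1 ∈ X ∧ t.2 ∈ X ∧ r t.1 t.2 ∧ f t.2 ≤ f t.1} +
      #{t : V × V | t.1 ∈ S \ X ∧ t.2 ∈ S \ X ∧ r t.1 t.2 ∧ g t.2 ≤ g t.1} +
      #{t : V × V | t.1 ∈ X ∧ t.2 ∈ S \ X ∧ t.1 ∈ S ∧ t.2 ∈ S ∧ r t.1 t.2} := by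
    refine (card_le_card ?_).trans
      ((card_union_le _ _).trans (Nat.add_le_add_right (card_union_le _ _) _))
    rintro ⟨x, y⟩
    simp only [mem_filter, mem_univ, true_and, mem_union, mem_sdiff]
    have := hbound x
    split_ifs <;> grind
  set N1 : Finset (V × V) := {t | t.1 ∈ X ∧ t.2 ∈ X ∧ t.1 ≠ t.2 ∧ ¬ r t.1 t.2 ∧ ¬ r t.2 t.1}
    with hN1
  set N2 : Finset (V × V) :=
    {t | t.1 ∈ S \ X ∧ t.2 ∈ S \ X ∧ t.1 ≠ t.2 ∧ ¬ r t.1 t.2 ∧ ¬ r t.2 t.1} with hN2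
  set N3 : Finset (V × V) := {t | t.1 ∈ X ∧ t.2 ∈ S \ X ∧
    ¬ (t.1 ∈ S ∧ t.2 ∈ S ∧ r t.1 t.2) ∧ ¬ (t.2 ∈ S ∧ t.1 ∈ S ∧ r t.2 t.1)} with hN3
  have hnon : #N1 + #N2 + #N3 + #(N3.map (Equiv.prodComm V V).toEmbedding) ≤
      #{t : V × V | t.1 ∈ S ∧ t.2 ∈ S ∧ t.1 ≠ t.2 ∧ ¬ r t.1 t.2 ∧ ¬ r t.2 t.1} := by
    rw [← card_union_of_disjoint, ← card_union_of_disjoint, ← card_union_of_disjoint]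
    · refine card_le_card ?_
      rintro ⟨x, y⟩
      have hx := @hXS x
      have hy := @hXS y
      simp only [hN1, hN2, hN3, mem_union, mem_map_equiv, mem_filter, mem_univ, true_and,
        mem_sdiff, Equiv.prodComm_symm, Equiv.prodComm_apply, Prod.fst_swap, Prod.snd_swap]
      grind
    all_goals
      rw [Finset.disjoint_left]
      rintro ⟨x, y⟩
      simp only [hN1, hN2, hN3, mem_union, mem_map_equiv, mem_filter, mem_univ, true_and,
        mem_sdiff, Equiv.prodComm_symm, Equiv.prodComm_apply, Prod.fst_swap, Prod.snd_swap]
      tauto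
  rw [card_map] at hnon
  have := Nat.mul_le_mul_left (m - 2) harcs
  simp only [mul_add] at this
  replace hcut : (m - 2) * #{t : V × V | t.1 ∈ X ∧ t.2 ∈ S \ X ∧ t.1 ∈ S ∧ t.2 ∈ S ∧ r t.1 t.2} ≤
      #N3 := by convert hcut
  beta_reduce
  omega

end Cuts

namespace SimpleDigraph

variable {V : Type*}

theorem MFree.relFree {G : SimpleDigraph V} {m : ℕ} (hG : G.MFree m) : RelFree G.Adj m := by
  intro k
  induction k using Nat.strong_induction_on with
  | _ k ih =>
  intro v hk1 hkm hw
  obtain ⟨p, h0, hk, hp⟩ := hw.exists_fun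
  obtain ⟨k, rfl⟩ := Nat.exists_eq_add_of_le' hk1
  have hinj : ∀ a b, a < b → b < k + 1 → p a ≠ p b := by
    intro a b hab hb heq
    have hwalk : RelWalk G.Adj (b - a) (p a) (p (a + (b - a))) :=
      RelWalk.of_fun fun i hi => hp (a + i) (by omega)
    rw [Nat.add_sub_cancel' hab.le, ← heq] at hwalk
    exact ih (b - a) (by omega) _ (by omega) (by omega) hwalk
  have hcyc : G.IsCycle ((List.range (k + 1)).map p) := by
    refine ⟨by simp, ?_, ?_, p k, p 0, ?_, ?_, ?_⟩
    · refine List.Nodup.map_on (fun a ha b hb heq => ?_) List.nodup_range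
      rw [List.mem_range] at ha hb
      rcases lt_trichotomy a b with h | h | h
      · exact absurd heq (hinj a b h hb)
      · exact h
      · exact absurd heq.symm (hinj b a h ha)
    · refine List.isChain_iff_getElem.2 fun i hi => ?_
      simp only [List.length_map, List.length_range] at hi
      simpa using hp i (by omega)
    · simp [List.range_succ]
    · simp [List.range_succ_eq_map]
    · have := hp k (by omega)
      rwa [hk, ← h0] at this
  have := hG _ hcyc
  simp at this
  omega

theorem acyclic_of_rank {G : SimpleDigraph V} (f : V → ℕ) (h : ∀ a b, G.Adj a b → f a < f b) :
    G.Acyclic := by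
  rintro l ⟨hne, -, hchain, a, b, ha, hb, hab⟩
  have hpair : (l.map f).Pairwise (· < ·) := by
    rw [← List.isChain_iff_pairwise, List.isChain_map]
    exact hchain.imp h
  rw [List.pairwise_map] at hpair
  have hlt := h a b hab
  cases l with
  | nil => exact hne rfl
  | cons c l =>
    obtain rfl : c = b := by simpa using hb
    rcases List.mem_cons.1 (List.mem_of_getLast? ha) with rfl | hmem
    · exact lt_irrefl _ hlt
    · exact lt_asymm hlt (List.rel_of_pairwise_cons hpair hmem)

open Classical Finset in
theorem beta_le_of_rank [Fintype V] (G : SimpleDigraph V) (f : V → ℕ) :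
    G.beta ≤ #{t : V × V | G.Adj t.1 t.2 ∧ f t.2 ≤ f t.1} := by
  refine Nat.sInf_le ⟨{t | G.Adj t.1 t.2 ∧ f t.2 ≤ f t.1}, fun t ht => ht.1, ?_, ?_⟩
  · rw [← Set.ncard_coe_finset]
    simp
  · refine acyclic_of_rank f fun a b ⟨hab, hnot⟩ => ?_
    by_contra hle
    exact hnot ⟨hab, not_lt.1 hle⟩

open Classical Finset in
theorem card_nonadj_le [Fintype V] (G : SimpleDigraph V) :
    #{t : V × V | t.1 ≠ t.2 ∧ ¬ G.Adj t.1 t.2 ∧ ¬ G.Adj t.2 t.1} ≤ 2 * G.gamma := by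
  rw [gamma, Set.ncard_eq_toFinset_card']
  refine card_le_mul_card_image_of_maps_to (f := fun t : V × V => s(t.1, t.2)) ?_ 2 ?_
  · rintro ⟨a, b⟩ h
    simp only [mem_filter, mem_univ, true_and] at h
    simp only [Set.mem_toFinset, Set.mem_ofPred_eq, Sym2.mk_isDiag_iff]
    refine ⟨h.1, fun u w huw => ?_⟩
    rcases Sym2.eq_iff.1 huw with ⟨rfl, rfl⟩ | ⟨rfl, rfl⟩
    · exact h.2
    · exact h.2.symm
  · intro e _
    induction e with
    | _ a b =>
    refine (card_le_card (t := {(a, b), (b, a)}) ?_).trans card_le_two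
    rintro ⟨x, y⟩ h
    simpa using (mem_filter.1 h).2

end SimpleDigraph

theorem stmt13 {V : Type*} [Fintype V] (G : SimpleDigraph V) (m : ℕ)
    (hm : 4 ≤ m) (hG : G.MFree m) :
    (m - 2) * G.beta ≤ G.gamma := by
  classical
  obtain ⟨f, hf⟩ := exists_rank hm hG.relFree Finset.univ
  have hβ := Nat.mul_le_mul_left (m - 2) (G.beta_le_of_rank f)
  have hγ := G.card_nonadj_le
  simp only [Finset.mem_univ, true_and] at hf
  have := hf.trans hγ
  omega
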